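/- Let μ be a Borel probability measure on ℝ^d with support X, let c, t > 0, let r = (c n^{−t})_{n≥1}, and let α ∈ ℝ. (1) If 1/t < α and Δ^loc(α) = {x ∈ X : ldim(μ,x) = α} is non-empty, then ℙ_μ({ω : Δ^loc(α) ⊆ E_r(ω)}) = 0. (2) If 1/t > α, then ℙ_μ({ω : Δ̲^loc(α) ⊆ E_r(ω)}) = 1, where Δ̲^loc(α) = {x ∈ X : ldim(μ,x) ≤ α}. -/

import Mathlib

open MeasureTheory Metric Filter Set
open scoped ENNReal Topology

noncomputable section

variable {d : ℕ}

/-- The random covering set `E_r(ω) = limsup_n B(ω_n, r_n)` in `ℝ^d`. -/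
def coverSet (r : ℕ → ℝ) (ω : ℕ → EuclideanSpace ℝ (Fin d)) : Set (EuclideanSpace ℝ (Fin d)) :=
  ⋂ k, ⋃ n, ⋃ (_ : k ≤ n), ball (ω n) (r n)

/-- The topological support of a measure. -/
def msupport (μ : Measure (EuclideanSpace ℝ (Fin d))) : Set (EuclideanSpace ℝ (Fin d)) :=
  {x | ∀ U : Set (EuclideanSpace ℝ (Fin d)), IsOpen U → x ∈ U → 0 < μ U}

/-- The lower local dimension `liminf_{ρ→0} log μ(B(x,ρ)) / log ρ` of `μ` at `x`. -/
def ldim (μ : Measure (EuclideanSpace ℝ (Fin d))) (x : EuclideanSpace ℝ (Fin d)) : EReal :=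
  liminf (fun ρ : ℝ => ((Real.log (μ (ball x ρ)).toReal / Real.log ρ : ℝ) : EReal)) (𝓝[>] 0)

/-- The level set `Δ^loc(α)` of the lower local dimension. -/
def levelSet (μ : Measure (EuclideanSpace ℝ (Fin d))) (α : ℝ) : Set (EuclideanSpace ℝ (Fin d)) :=
  {x ∈ msupport μ | ldim μ x = (α : EReal)}

/-- The sub-level set `Δ̲^loc(α)` of the lower local dimension. -/
def subLevelSet (μ : Measure (EuclideanSpace ℝ (Fin d))) (α : ℝ) :
    Set (EuclideanSpace ℝ (Fin d)) :=
  {x ∈ msupport μ | ldim μ x ≤ (α : EReal)}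

/-- Balls of equal radius and of measure at least `p` have centres that are `2ρ`-close to a finite
set of at most `1 / p` of them. -/
lemma exists_finset_dist_lt_of_le_measure_ball {E : Type*} [PseudoMetricSpace E]
    [MeasurableSpace E] [OpensMeasurableSpace E] (μ : Measure E) [IsProbabilityMeasure μ]
    {ρ p : ℝ} (hρ : 0 < ρ) (hp : 0 < p) :
    ∃ F : Finset E, (F.card : ℝ) * p ≤ 1 ∧ (∀ y ∈ F, p ≤ μ.real (ball y ρ)) ∧
      ∀ x, p ≤ μ.real (ball x ρ) → ∃ y ∈ F, dist x y < 2 * ρ := by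
  set A : Set E := {x | p ≤ μ.real (ball x ρ)}
  obtain ⟨u, huA, hdisj, hu⟩ := Vitali.exists_disjoint_subfamily_covering_enlargement
    (fun x : E => ball x ρ) A (fun _ => (1 : ℝ)) 2 one_lt_two (fun _ _ => zero_le_one) 1
    (fun _ _ => le_rfl) (fun x _ => ⟨x, mem_ball_self hρ⟩)
  have hcard : ∀ F : Finset E, (F : Set E) ⊆ u → (F.card : ℝ) * p ≤ 1 := by
    intro F hF
    calc (F.card : ℝ) * p = ∑ _y ∈ F, p := by simp
      _ ≤ ∑ y ∈ F, μ.real (ball y ρ) := Finset.sum_le_sum fun y hy => huA (hF hy)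
      _ = μ.real (⋃ y ∈ F, ball y ρ) :=
        (measureReal_biUnion_finset (hdisj.subset hF) fun _ _ => measurableSet_ball).symm
      _ ≤ 1 := measureReal_le_one
  have hfin : u.Finite := by
    by_contra hinf
    obtain ⟨n, hn⟩ := exists_nat_gt (1 / p)
    obtain ⟨F, hF, rfl⟩ := Set.Infinite.exists_subset_card_eq hinf n
    rw [div_lt_iff₀ hp] at hn
    exact (hcard F hF).not_gt hn
  refine ⟨hfin.toFinset, hcard _ (by simp), fun y hy => huA (by simpa using hy), fun x hx => ?_⟩
  obtain ⟨y, hy, ⟨z, hzx, hzy⟩, -⟩ := hu x hx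
  refine ⟨y, by simpa using hy, ?_⟩
  rw [mem_ball] at hzx hzy
  linarith [dist_triangle_left x y z]

/-- Among independent samples with indices in `[M, 2M)`, with large probability some sample is
close to any given point around which `μ` has mass at least `p`. -/
lemma exists_measure_le_and_exists_dist_lt {E : Type*} [PseudoMetricSpace E]
    [MeasurableSpace E] [OpensMeasurableSpace E] (μ : Measure E) [IsProbabilityMeasure μ]
    (P : Measure (ℕ → E))
    (hP : ∀ (s : Finset ℕ) (f : ℕ → Set E), (∀ n, MeasurableSet (f n)) →
      P {ω | ∀ n ∈ s, ω n ∈ f n} = ∏ n ∈ s, μ (f n))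
    {ρ p : ℝ} (hρ : 0 < ρ) (hp : 0 < p) (M : ℕ) :
    ∃ B : Set (ℕ → E), P B ≤ ENNReal.ofReal (1 / p * Real.exp (-p * M)) ∧
      ∀ ω ∉ B, ∀ x, p ≤ μ.real (ball x ρ) → ∃ n ∈ Finset.Ico M (2 * M), dist x (ω n) < 3 * ρ := by
  obtain ⟨F, hcard, hF, hcov⟩ := exists_finset_dist_lt_of_le_measure_ball μ hρ hp
  refine ⟨⋃ y ∈ F, {ω | ∀ n ∈ Finset.Ico M (2 * M), ω n ∈ (ball y ρ)ᶜ}, ?_, ?_⟩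
  · have hmiss : ∀ y ∈ F, P {ω | ∀ n ∈ Finset.Ico M (2 * M), ω n ∈ (ball y ρ)ᶜ} ≤
        ENNReal.ofReal (Real.exp (-p * M)) := by
      intro y hy
      rw [hP _ (fun _ => (ball y ρ)ᶜ) fun _ => measurableSet_ball.compl, Finset.prod_const,
        Nat.card_Ico, show 2 * M - M = M by omega, ← ofReal_measureReal,
        ← ENNReal.ofReal_pow measureReal_nonneg, mul_comm, Real.exp_nat_mul]
      gcongr
      rw [probReal_compl_eq_one_sub measurableSet_ball]
      linarith [hF y hy, Real.one_sub_le_exp_neg p]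
    calc P (⋃ y ∈ F, {ω | ∀ n ∈ Finset.Ico M (2 * M), ω n ∈ (ball y ρ)ᶜ})
        ≤ ∑ y ∈ F, P {ω | ∀ n ∈ Finset.Ico M (2 * M), ω n ∈ (ball y ρ)ᶜ} :=
          measure_biUnion_finset_le _ _
      _ ≤ ∑ _y ∈ F, ENNReal.ofReal (Real.exp (-p * M)) := Finset.sum_le_sum hmiss
      _ = ENNReal.ofReal (F.card * Real.exp (-p * M)) := by
          rw [Finset.sum_const, nsmul_eq_mul, ENNReal.ofReal_mul (by positivity),
            ENNReal.ofReal_natCast]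
      _ ≤ _ := by
          gcongr
          rwa [le_div_iff₀ hp]
  · intro ω hω x hx
    obtain ⟨y, hy, hxy⟩ := hcov x hx
    simp only [mem_iUnion, mem_ofPred_eq, not_exists, not_forall, mem_compl_iff, not_not] at hω
    obtain ⟨n, hn, hyn⟩ := hω y hy
    rw [mem_ball] at hyn
    exact ⟨n, hn, by linarith [dist_triangle_right x (ω n) y]⟩

lemma measureReal_ball_pos_of_mem_msupport {μ : Measure (EuclideanSpace ℝ (Fin d))}
    [IsFiniteMeasure μ] {x : EuclideanSpace ℝ (Fin d)} (hx : x ∈ msupport μ) {ρ : ℝ}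
    (hρ : 0 < ρ) : 0 < μ.real (ball x ρ) :=
  ENNReal.toReal_pos (hx _ isOpen_ball (mem_ball_self hρ)).ne' (measure_ne_top _ _)

lemma eventually_measureReal_ball_lt_rpow {μ : Measure (EuclideanSpace ℝ (Fin d))}
    [IsFiniteMeasure μ] {x : EuclideanSpace ℝ (Fin d)} (hx : x ∈ msupport μ) {β : ℝ}
    (hβ : (β : EReal) < ldim μ x) : ∀ᶠ ρ in 𝓝[>] (0 : ℝ), μ.real (ball x ρ) < ρ ^ β := by
  filter_upwards [eventually_lt_of_lt_liminf hβ, Ioo_mem_nhdsGT (zero_lt_one' ℝ)]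
    with ρ hρ hρ01
  have hpos := measureReal_ball_pos_of_mem_msupport hx hρ01.1
  rw [EReal.coe_lt_coe_iff, lt_div_iff_of_neg (Real.log_neg hρ01.1 hρ01.2)] at hρ
  rwa [Real.lt_rpow_iff_log_lt hpos hρ01.1]

lemma frequently_rpow_lt_measureReal_ball {μ : Measure (EuclideanSpace ℝ (Fin d))}
    [IsFiniteMeasure μ] {x : EuclideanSpace ℝ (Fin d)} (hx : x ∈ msupport μ) {β : ℝ}
    (hβ : ldim μ x < (β : EReal)) : ∃ᶠ ρ in 𝓝[>] (0 : ℝ), ρ ^ β < μ.real (ball x ρ) := by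
  refine ((frequently_lt_of_liminf_lt (by isBoundedDefault) hβ).and_eventually
    (Ioo_mem_nhdsGT (zero_lt_one' ℝ))).mono ?_
  rintro ρ ⟨hρ, hρ01⟩
  have hpos := measureReal_ball_pos_of_mem_msupport hx hρ01.1
  rw [EReal.coe_lt_coe_iff, div_lt_iff_of_neg (Real.log_neg hρ01.1 hρ01.2)] at hρ
  rwa [Real.rpow_lt_iff_lt_log hρ01.1 hpos]

lemma summable_rpow_mul_exp_neg_mul_rpow {a s : ℝ} (ha : 0 < a) (hs : s < 1) :
    Summable fun n : ℕ => (n : ℝ) ^ s * Real.exp (-a * (n : ℝ) ^ (1 - s)) := by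
  have hs' : 0 < 1 - s := by linarith
  have hexp := ((isLittleO_exp_neg_mul_rpow_atTop ha (-(s + 2) / (1 - s))).comp_tendsto
    ((tendsto_rpow_atTop hs').comp tendsto_natCast_atTop_atTop)).isBigO
  have h2 : Summable fun n : ℕ => (n : ℝ) ^ (-2 : ℝ) :=
    Real.summable_nat_rpow.2 (by norm_num)
  refine summable_of_isBigO_nat h2
    (((Asymptotics.isBigO_refl (fun n : ℕ => (n : ℝ) ^ s) atTop).mul hexp).congr' ?_ ?_)
  · exact Eventually.of_forall fun n => rfl
  · filter_upwards [eventually_gt_atTop 0] with n hn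
    have hn' : (0 : ℝ) < n := by exact_mod_cast hn
    simp only [Function.comp_apply]
    rw [← Real.rpow_mul hn'.le, ← Real.rpow_add hn']
    congr 1
    field_simp
    ring

lemma measure_mem_coverSet_eq_zero (μ : Measure (EuclideanSpace ℝ (Fin d)))
    (P : Measure (ℕ → EuclideanSpace ℝ (Fin d)))
    (hP : ∀ (s : Finset ℕ) (f : ℕ → Set (EuclideanSpace ℝ (Fin d))),
      (∀ n, MeasurableSet (f n)) →
      P {ω | ∀ n ∈ s, ω n ∈ f n} = ∏ n ∈ s, μ (f n))
    {r : ℕ → ℝ} {x : EuclideanSpace ℝ (Fin d)} (hsum : ∑' n, μ (ball x (r n)) ≠ ∞) :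
    P {ω | x ∈ coverSet r ω} = 0 := by
  have hmeas : ∀ n, P {ω | ω n ∈ ball x (r n)} = μ (ball x (r n)) := by
    intro n
    simpa using hP {n} (fun _ => ball x (r n)) fun _ => measurableSet_ball
  have hBC := measure_setOfPred_frequently_eq_zero (μ := P) (p := fun n ω => ω n ∈ ball x (r n))
    (by simpa only [hmeas] using hsum)
  refine measure_mono_null (fun ω hω => ?_) hBC
  simp only [coverSet, mem_ofPred_eq, mem_iInter, mem_iUnion] at hω
  simp only [mem_ofPred_eq, frequently_atTop]
  intro k
  obtain ⟨n, hkn, hn⟩ := hω k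
  exact ⟨n, hkn, by rwa [mem_ball_comm]⟩

lemma tendsto_const_mul_rpow_neg_nhdsGT {c t : ℝ} (hc : 0 < c) (ht : 0 < t) :
    Tendsto (fun n : ℕ => c * ((n + 1 : ℕ) : ℝ) ^ (-t)) atTop (𝓝[>] 0) := by
  refine tendsto_nhdsWithin_iff.2 ⟨?_, Eventually.of_forall fun n => ?_⟩
  · have h := ((tendsto_rpow_neg_atTop ht).comp
      (tendsto_natCast_atTop_atTop.comp (tendsto_add_atTop_nat 1))).const_mul c
    simpa using h
  · rw [mem_Ioi]
    positivity

lemma measure_levelSet_subset_coverSet_eq_zero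
    (μ : Measure (EuclideanSpace ℝ (Fin d))) [IsFiniteMeasure μ]
    (P : Measure (ℕ → EuclideanSpace ℝ (Fin d)))
    (hP : ∀ (s : Finset ℕ) (f : ℕ → Set (EuclideanSpace ℝ (Fin d))),
      (∀ n, MeasurableSet (f n)) →
      P {ω | ∀ n ∈ s, ω n ∈ f n} = ∏ n ∈ s, μ (f n))
    {c t : ℝ} (hc : 0 < c) (ht : 0 < t)
    {r : ℕ → ℝ} (hr : ∀ n : ℕ, r n = c * ((n + 1 : ℕ) : ℝ) ^ (-t))
    {α : ℝ} (hα : 1 / t < α) (hne : (levelSet μ α).Nonempty) :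
    P {ω | levelSet μ α ⊆ coverSet r ω} = 0 := by
  obtain ⟨x, hx⟩ := hne
  obtain ⟨β, htβ, hβα⟩ := exists_between hα
  have hs : 1 < t * β := by rwa [div_lt_iff₀' ht] at htβ
  refine measure_mono_null (fun ω hω => hω hx)
    (measure_mem_coverSet_eq_zero μ P hP (r := r) (x := x) ?_)
  have hlt := (tendsto_const_mul_rpow_neg_nhdsGT hc ht).eventually
    (eventually_measureReal_ball_lt_rpow hx.1 (β := β) (by rw [hx.2]; exact_mod_cast hβα))
  have hsum : Summable fun n : ℕ => c ^ β * ((n + 1 : ℕ) : ℝ) ^ (-(t * β)) :=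
    ((summable_nat_add_iff 1).2 (Real.summable_nat_rpow.2 (by linarith))).mul_left _
  have hreal : Summable fun n => μ.real (ball x (r n)) := by
    refine Summable.of_norm_bounded_eventually_nat hsum ?_
    filter_upwards [hlt] with n hn
    rw [Real.norm_of_nonneg measureReal_nonneg, hr]
    refine hn.le.trans_eq ?_
    rw [Real.mul_rpow hc.le (by positivity), ← Real.rpow_mul (by positivity), neg_mul]
  convert hreal.tsum_ofReal_ne_top with n
  exact (ofReal_measureReal).symm

lemma measure_subLevelSet_subset_coverSet_eq_one
    (μ : Measure (EuclideanSpace ℝ (Fin d))) [IsProbabilityMeasure μ]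
    (P : Measure (ℕ → EuclideanSpace ℝ (Fin d)))
    (hP : ∀ (s : Finset ℕ) (f : ℕ → Set (EuclideanSpace ℝ (Fin d))),
      (∀ n, MeasurableSet (f n)) →
      P {ω | ∀ n ∈ s, ω n ∈ f n} = ∏ n ∈ s, μ (f n))
    {c t : ℝ} (hc : 0 < c) (ht : 0 < t)
    {r : ℕ → ℝ} (hr : ∀ n : ℕ, r n = c * ((n + 1 : ℕ) : ℝ) ^ (-t))
    {α : ℝ} (hα : α < 1 / t) :
    P {ω | subLevelSet μ α ⊆ coverSet r ω} = 1 := by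
  have huniv : P univ = 1 := by simpa using hP ∅ (fun _ => univ) fun _ => .univ
  obtain ⟨β, hβ, hβt⟩ := exists_between (max_lt hα (by positivity : 0 < 1 / t))
  obtain ⟨hαβ, hβ0⟩ := max_lt_iff.1 hβ
  have hs : t * β < 1 := by rwa [lt_div_iff₀' ht] at hβt
  set b : ℝ := c * 2 ^ (-t) / 3 with hb
  have hb0 : 0 < b := by positivity
  set a : ℝ := b ^ β * 2 ^ (-(t * β)) with ha
  have ha0 : 0 < a := by positivity
  have hcast : ∀ M : ℕ, (0 : ℝ) < ((M + 1 : ℕ) : ℝ) := fun M => by positivity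
  choose B hPB hB using fun M : ℕ => exists_measure_le_and_exists_dist_lt μ P hP
    (mul_pos hb0 (Real.rpow_pos_of_pos (hcast M) (-t)))
    (mul_pos ha0 (Real.rpow_pos_of_pos (hcast M) (-(t * β)))) (M + 1)
  have hsum : ∑' M, P (B M) ≠ ∞ := by
    have h := ((summable_nat_add_iff 1).2
      (summable_rpow_mul_exp_neg_mul_rpow ha0 hs)).mul_left (1 / a)
    refine ne_top_of_le_ne_top h.tsum_ofReal_ne_top (ENNReal.tsum_le_tsum fun M => ?_)
    refine (hPB M).trans_eq (congrArg _ ?_)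
    rw [show 1 - t * β = -(t * β) + 1 by ring, Real.rpow_add_one (hcast M).ne',
      Real.rpow_neg (hcast M).le]
    field_simp
  have hae : ∀ᵐ ω ∂P, subLevelSet μ α ⊆ coverSet r ω := by
    filter_upwards [ae_eventually_notMem hsum] with ω hω x hx
    simp only [coverSet, mem_iInter, mem_iUnion, exists_prop]
    intro k
    obtain ⟨K, hK⟩ := eventually_atTop.1 hω
    set L : ℕ := max k K
    have hL : 0 < b * ((L + 1 : ℕ) : ℝ) ^ (-t) :=
      mul_pos hb0 (Real.rpow_pos_of_pos (hcast L) _)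
    obtain ⟨ρ, hρβ, hρ0, hρL⟩ := ((frequently_rpow_lt_measureReal_ball hx.1
      (hx.2.trans_lt (EReal.coe_lt_coe_iff.2 hαβ))).and_eventually (Ioo_mem_nhdsGT hL)).exists
    set y : ℝ := (b / ρ) ^ (1 / t) with hy
    have hy0 : 0 < y := by positivity
    have hρy : ρ = b * y ^ (-t) := by
      rw [hy, ← Real.rpow_mul (by positivity), one_div, mul_neg, inv_mul_cancel₀ ht.ne',
        Real.rpow_neg_one]
      field_simp
    have hLy : ((L + 1 : ℕ) : ℝ) ≤ y := by
      rw [hρy] at hρL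
      have := lt_of_mul_lt_mul_left hρL hb0.le
      rw [Real.rpow_lt_rpow_iff_of_neg hy0 (hcast L) (by linarith)] at this
      exact this.le
    obtain ⟨M, hM⟩ : ∃ M, ⌊y⌋₊ = M + 1 :=
      ⟨⌊y⌋₊ - 1, by have := Nat.le_floor hLy; omega⟩
    have hLM : L ≤ M := by have := Nat.le_floor hLy; omega
    have hMy : ((M + 1 : ℕ) : ℝ) ≤ y := hM ▸ Nat.floor_le hy0.le
    have hyM : y ≤ 2 * ((M + 1 : ℕ) : ℝ) := by
      have h1 : y < ((M + 1 : ℕ) : ℝ) + 1 := hM ▸ Nat.lt_floor_add_one y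
      push_cast at h1 ⊢
      linarith [(Nat.cast_nonneg M : (0 : ℝ) ≤ M)]
    have hball : a * ((M + 1 : ℕ) : ℝ) ^ (-(t * β)) ≤
        μ.real (ball x (b * ((M + 1 : ℕ) : ℝ) ^ (-t))) := by
      calc a * ((M + 1 : ℕ) : ℝ) ^ (-(t * β))
          = b ^ β * (2 * ((M + 1 : ℕ) : ℝ)) ^ (-(t * β)) := by
            rw [Real.mul_rpow zero_le_two (hcast M).le, ha, mul_assoc]
        _ ≤ b ^ β * y ^ (-(t * β)) := by
            gcongr ?_ * ?_
            exact Real.rpow_le_rpow_of_nonpos hy0 hyM (by nlinarith)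
        _ = ρ ^ β := by
            rw [hρy, Real.mul_rpow hb0.le (by positivity), ← Real.rpow_mul hy0.le, neg_mul]
        _ ≤ μ.real (ball x ρ) := hρβ.le
        _ ≤ _ := by
            refine measureReal_mono (ball_subset_ball ?_)
            rw [hρy]
            gcongr ?_ * ?_
            exact Real.rpow_le_rpow_of_nonpos (hcast M) hMy (by linarith)
    obtain ⟨n, hn, hdist⟩ := hB M ω (hK M ((le_max_right k K).trans hLM)) x hball
    rw [Finset.mem_Ico] at hn
    refine ⟨n, by have := le_max_left k K; omega, ?_⟩
    rw [mem_ball, hr]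
    refine hdist.trans_le ?_
    calc 3 * (b * ((M + 1 : ℕ) : ℝ) ^ (-t)) = c * (2 * ((M + 1 : ℕ) : ℝ)) ^ (-t) := by
          rw [Real.mul_rpow zero_le_two (hcast M).le, hb]
          ring
      _ ≤ c * ((n + 1 : ℕ) : ℝ) ^ (-t) := by
          gcongr ?_ * ?_
          refine Real.rpow_le_rpow_of_nonpos (hcast n) ?_ (by linarith)
          exact_mod_cast (by omega : n + 1 ≤ 2 * (M + 1))
  rw [measure_congr (eventuallyEq_univ.2 hae), huniv]

/-- For radii `r_n = c n^{-t}`: if `1/t < α` then the level set `Δ^loc(α)` (if non-empty) is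
a.s. not covered, while if `1/t > α` then the sub-level set `Δ̲^loc(α)` is a.s. covered. -/
theorem level_sets_covering
    (μ : Measure (EuclideanSpace ℝ (Fin d))) [IsProbabilityMeasure μ]
    (P : Measure (ℕ → EuclideanSpace ℝ (Fin d)))
    (hP : ∀ (s : Finset ℕ) (f : ℕ → Set (EuclideanSpace ℝ (Fin d))),
      (∀ n, MeasurableSet (f n)) →
      P {ω | ∀ n ∈ s, ω n ∈ f n} = ∏ n ∈ s, μ (f n))
    (c t : ℝ) (hc : 0 < c) (ht : 0 < t)
    (r : ℕ → ℝ) (hr : ∀ n : ℕ, r n = c * ((n + 1 : ℕ) : ℝ) ^ (-t))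
    (α : ℝ) :
    (1 / t < α → (levelSet μ α).Nonempty →
        P {ω | levelSet μ α ⊆ coverSet r ω} = 0) ∧
    (α < 1 / t →
        P {ω | subLevelSet μ α ⊆ coverSet r ω} = 1) := by
  exact ⟨fun hα hne => measure_levelSet_subset_coverSet_eq_zero μ P hP hc ht hr hα hne,
    fun hα => measure_subLevelSet_subset_coverSet_eq_one μ P hP hc ht hr hα⟩

end
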